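/- arXiv:2008.07938 — 13 statements merged into one kernel-verified Lean document; each statement's English description precedes it below -/
import Mathlib

section
/- For every (x,y) in the open triangle Δ, the series Σ_{k=0}^∞ (1/(kx+y+1)^3) · h(1/(kx+y+1), x/(kx+y+1)) converges and equals h(x,y), where h(u,v) = 1/(u(v+1)). That is, h(x,y) = 1/(x(y+1)) is an eigenfunction of eigenvalue 1 of the transfer operator of the triangle partition map T_{e,e,e}. -/
/-- The partial sums of the series telescope. -/
theorem sum_range_transfer_eee (x y : ℝ) (hy : 0 < y) (hx : 0 < x) (n : ℕ) :
    ∑ k ∈ Finset.range n, (1 / ((k : ℝ) * x + y + 1) ^ 3) *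
        (1 / ((1 / ((k : ℝ) * x + y + 1)) * (x / ((k : ℝ) * x + y + 1) + 1))) =
      1 / (x * (y + 1)) - 1 / x * ((n : ℝ) * x + y + 1)⁻¹ := by
  induction n with
  | zero =>
    have : y + 1 ≠ 0 := by positivity
    simp
    field_simp
    ring
  | succ n ih =>
    rw [Finset.sum_range_succ, ih]
    have hD : 0 < (n : ℝ) * x + y + 1 := by positivity
    have hs : ((n + 1 : ℕ) : ℝ) * x + y + 1 = ((n : ℝ) * x + y + 1) + x := by
      push_cast
      ring
    rw [hs]
    generalize (n : ℝ) * x + y + 1 = D at hD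
    have hDx : D + x ≠ 0 := by positivity
    have hxD : x / D + 1 = (D + x) / D := by
      field_simp
      ring
    rw [hxD]
    field_simp
    ring

/-- The function `h(x,y) = 1/(x(y+1))` is an eigenfunction of eigenvalue 1 of the
transfer operator of the triangle partition map `T_{e,e,e}`: for every `(x,y)` in the
open triangle `Δ = {0 < y < x < 1}`, the series
`Σ_k (1/(kx+y+1)^3) · h(1/(kx+y+1), x/(kx+y+1))` converges and equals `h(x,y)`. -/
theorem trip_eee_eigenfunction (x y : ℝ) (hy : 0 < y) (hyx : y < x) (hx : x < 1) :
    HasSum (fun k : ℕ =>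
      (1 / ((k : ℝ) * x + y + 1) ^ 3) *
        (1 / ((1 / ((k : ℝ) * x + y + 1)) * (x / ((k : ℝ) * x + y + 1) + 1))))
      (1 / (x * (y + 1))) := by
  have hx0 : 0 < x := hy.trans hyx
  rw [hasSum_iff_tendsto_nat_of_nonneg (fun k => by positivity)]
  simp only [sum_range_transfer_eee x y hy hx0]
  have hD : Filter.Tendsto (fun n : ℕ => (n : ℝ) * x + y + 1) Filter.atTop Filter.atTop :=
    Filter.tendsto_atTop_add_const_right _ _ <| Filter.tendsto_atTop_add_const_right _ _ <|
      tendsto_natCast_atTop_atTop.atTop_mul_const hx0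
  simpa using (hD.inv_tendsto_atTop.const_mul (1 / x)).const_sub (1 / (x * (y + 1)))
end

section
/- For every (x,y) in the open triangle Δ, the series Σ_{k=0}^∞ (1/((k+1)x−y+1)^3) · h(1/((k+1)x−y+1), x/((k+1)x−y+1)) converges and equals h(x,y), where h(u,v) = 1/(u(1−v)). That is, h(x,y) = 1/(x(1−y)) is an eigenfunction of eigenvalue 1 of the transfer operator of the triangle partition map T_{e,23,e}. -/
/-- The function `h(x,y) = 1/(x(1−y))` is an eigenfunction of eigenvalue 1 of the
transfer operator of the triangle partition map `T_{e,23,e}`: for every `(x,y)` in the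
open triangle `Δ = {0 < y < x < 1}`, writing `D_k = (k+1)x − y + 1`, the series
`Σ_k (1/D_k^3) · h(1/D_k, x/D_k)` converges and equals `h(x,y)`. -/
theorem trip_e23e_eigenfunction (x y : ℝ) (hy : 0 < y) (hyx : y < x) (hx : x < 1) :
    HasSum (fun k : ℕ =>
      (1 / (((k : ℝ) + 1) * x - y + 1) ^ 3) *
        (1 / ((1 / (((k : ℝ) + 1) * x - y + 1)) *
          (1 - x / (((k : ℝ) + 1) * x - y + 1)))))
      (1 / (x * (1 - y))) := by
  have hx0 : 0 < x := hy.trans hyx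
  have hpos (k : ℕ) : 0 < (k : ℝ) * x - y + 1 := by
    have : 0 ≤ (k : ℝ) * x := by positivity
    linarith
  have hterm (k : ℕ) :
      (1 / (((k : ℝ) + 1) * x - y + 1) ^ 3) *
        (1 / ((1 / (((k : ℝ) + 1) * x - y + 1)) *
          (1 - x / (((k : ℝ) + 1) * x - y + 1)))) =
      1 / ((((k : ℝ) + 1) * x - y + 1) * ((k : ℝ) * x - y + 1)) := by
    have h₁ := (hpos k).ne'
    have h₂ : ((k : ℝ) + 1) * x - y + 1 ≠ 0 := by exact_mod_cast (hpos (k + 1)).ne'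
    have h₃ : 1 - x / (((k : ℝ) + 1) * x - y + 1) =
        ((k : ℝ) * x - y + 1) / (((k : ℝ) + 1) * x - y + 1) := by
      rw [eq_div_iff h₂, sub_mul, div_mul_cancel₀ _ h₂]
      ring
    rw [h₃]
    field_simp
  have hsum (n : ℕ) :
      ∑ k ∈ Finset.range n, 1 / ((((k : ℝ) + 1) * x - y + 1) * ((k : ℝ) * x - y + 1)) =
        1 / (x * (1 - y)) - 1 / x * ((n : ℝ) * x - y + 1)⁻¹ := by
    induction n with
    | zero =>
      have h₀ : 1 - y ≠ 0 := by linarith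
      simp only [Finset.range_zero, Finset.sum_empty, Nat.cast_zero, zero_mul, zero_sub]
      rw [neg_add_eq_sub]
      field_simp
      simp
    | succ n ih =>
      have h₁ := (hpos n).ne'
      have h₂ : ((n : ℝ) + 1) * x - y + 1 ≠ 0 := by exact_mod_cast (hpos (n + 1)).ne'
      rw [Finset.sum_range_succ, ih]
      push_cast
      have h₃ : 1 / ((((n : ℝ) + 1) * x - y + 1) * ((n : ℝ) * x - y + 1)) =
          1 / x * ((n : ℝ) * x - y + 1)⁻¹ - 1 / x * (((n : ℝ) + 1) * x - y + 1)⁻¹ := by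
        field_simp
        ring
      rw [h₃]
      ring
  have hlim : Filter.Tendsto (fun n : ℕ => (n : ℝ) * x - y + 1) Filter.atTop Filter.atTop := by
    refine Filter.tendsto_atTop_add_const_right _ _ ?_
    simp only [sub_eq_add_neg]
    exact Filter.tendsto_atTop_add_const_right _ _
      (tendsto_natCast_atTop_atTop.atTop_mul_const hx0)
  simp only [hterm]
  rw [hasSum_iff_tendsto_nat_of_nonneg]
  · simp only [hsum]
    simpa using (hlim.inv_tendsto_atTop.const_mul (1 / x)).const_sub (1 / (x * (1 - y)))
  · intro k
    have h₁ := hpos k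
    have h₂ : 0 < ((k : ℝ) + 1) * x - y + 1 := by exact_mod_cast hpos (k + 1)
    positivity
end

section
/- For every (x,y) in the open triangle Δ, writing D_k = x+(k+1)(1−y), the series Σ_{k=0}^∞ (1/D_k^3) · h(1/D_k, (1−y)/D_k) converges and equals h(x,y), where h(u,v) = 1/(u(1−v)). That is, h(x,y) = 1/(x(1−y)) is an eigenfunction of eigenvalue 1 of the transfer operator of the triangle partition map T_{e,132,e}. -/
/-- The function `h(x,y) = 1/(x(1−y))` is an eigenfunction of eigenvalue 1 of the
transfer operator of the triangle partition map `T_{e,132,e}`: for every `(x,y)` in the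
open triangle `Δ = {0 < y < x < 1}`, writing `D_k = x + (k+1)(1−y)`, the series
`Σ_k (1/D_k^3) · h(1/D_k, (1−y)/D_k)` converges and equals `h(x,y)`. -/
theorem trip_e132e_eigenfunction (x y : ℝ) (hy : 0 < y) (hyx : y < x) (hx : x < 1) :
    HasSum (fun k : ℕ =>
      (1 / (x + ((k : ℝ) + 1) * (1 - y)) ^ 3) *
        (1 / ((1 / (x + ((k : ℝ) + 1) * (1 - y))) *
          (1 - (1 - y) / (x + ((k : ℝ) + 1) * (1 - y))))))
      (1 / (x * (1 - y))) := by
  have hc : 0 < 1 - y := by linarith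
  have hx0 : 0 < x := hy.trans hyx
  have hpos (k : ℕ) : 0 < x + (k : ℝ) * (1 - y) := by positivity
  set g : ℕ → ℝ := fun k => 1 / ((x + (k : ℝ) * (1 - y)) * (1 - y)) with hg
  have hterm (k : ℕ) :
      (1 / (x + ((k : ℝ) + 1) * (1 - y)) ^ 3) *
        (1 / ((1 / (x + ((k : ℝ) + 1) * (1 - y))) *
          (1 - (1 - y) / (x + ((k : ℝ) + 1) * (1 - y))))) = g k - g (k + 1) := by
    have h0 := (hpos k).ne'
    have h1 : x + ((k : ℝ) + 1) * (1 - y) ≠ 0 := by exact_mod_cast (hpos (k + 1)).ne'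
    have h2 : 1 - (1 - y) / (x + ((k : ℝ) + 1) * (1 - y)) =
        (x + (k : ℝ) * (1 - y)) / (x + ((k : ℝ) + 1) * (1 - y)) := by
      rw [eq_div_iff h1, sub_mul, div_mul_cancel₀ _ h1]
      ring
    have h3 := hc.ne'
    simp only [hg, Nat.cast_add, Nat.cast_one]
    rw [h2]
    generalize hA : x + (k : ℝ) * (1 - y) = A at *
    generalize hB : x + ((k : ℝ) + 1) * (1 - y) = B at *
    have hAB : B = A + (1 - y) := by rw [← hA, ← hB]; ring
    field_simp
    rw [hAB]
    ring
  simp only [hterm]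
  have hlim : Filter.Tendsto g Filter.atTop (nhds 0) := by
    refine Filter.Tendsto.const_div_atTop ?_ 1
    exact (Filter.tendsto_atTop_add_const_left _ x
      (tendsto_natCast_atTop_atTop.atTop_mul_const hc)).atTop_mul_const hc
  rw [hasSum_iff_tendsto_nat_of_nonneg]
  · simp only [Finset.sum_range_sub']
    simpa [hg] using hlim.const_sub (g 0)
  · intro k
    rw [sub_nonneg]
    have := hpos k
    simp only [hg, Nat.cast_add, Nat.cast_one]
    gcongr
    linarith
end

section
/- For every (x,y) in the open triangle Δ, writing D_k = k(1−x+y)+y+1, the series Σ_{k=0}^∞ (1/D_k^3) · h((D_k−x+y)/D_k, (1−x+y)/D_k) converges and equals h(x,y), where h(u,v) = 1/((v+1)(1−u+v)). That is, h(x,y) = 1/((y+1)(1−x+y)) is an eigenfunction of eigenvalue 1 of the transfer operator of the triangle partition map T_{12,12,12}. -/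
/-- The telescoping series `Σ_k 1/((kw+a)((k+1)w+a))` has sum `1/(aw)`. -/
theorem hasSum_one_div_mul_succ_linear {a w : ℝ} (ha : 0 < a) (hw : 0 < w) :
    HasSum (fun k : ℕ => 1 / (((k : ℝ) * w + a) * (((k : ℝ) + 1) * w + a)))
      (1 / (a * w)) := by
  rw [hasSum_iff_tendsto_nat_of_nonneg (fun k => by positivity)]
  have partial_sum : ∀ n : ℕ,
      ∑ k ∈ Finset.range n, 1 / (((k : ℝ) * w + a) * (((k : ℝ) + 1) * w + a)) =
        1 / (a * w) - w⁻¹ * ((n : ℝ) * w + a)⁻¹ := by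
    intro n
    induction n with
    | zero => simp [mul_comm]
    | succ n ih =>
      rw [Finset.sum_range_succ, ih]
      push_cast
      have h₁ : (n : ℝ) * w + a ≠ 0 := by positivity
      have h₂ : ((n : ℝ) + 1) * w + a ≠ 0 := by positivity
      field_simp
      ring
  simp only [partial_sum]
  have denominator_atTop :
      Filter.Tendsto (fun n : ℕ => (n : ℝ) * w + a) Filter.atTop Filter.atTop :=
    Filter.tendsto_atTop_add_const_right _ _
      (tendsto_natCast_atTop_atTop.atTop_mul_const hw)
  simpa using (denominator_atTop.inv_tendsto_atTop.const_mul w⁻¹).const_sub (1 / (a * w))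

/-- The function `h(x,y) = 1/((y+1)(1−x+y))` is an eigenfunction of eigenvalue 1 of the
transfer operator of the triangle partition map `T_{12,12,12}`: for every `(x,y)` in the
open triangle `Δ = {0 < y < x < 1}`, writing `D_k = k(1−x+y)+y+1`, the series
`Σ_k (1/D_k^3) · h((D_k−x+y)/D_k, (1−x+y)/D_k)` converges and equals `h(x,y)`,
where `h(u,v) = 1/((v+1)(1−u+v))`. -/
theorem trip_121212_eigenfunction (x y : ℝ) (hy : 0 < y) (hyx : y < x) (hx : x < 1) :
    HasSum (fun k : ℕ =>
      (1 / ((k : ℝ) * (1 - x + y) + y + 1) ^ 3) *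
        (1 / (((1 - x + y) / ((k : ℝ) * (1 - x + y) + y + 1) + 1) *
          (1 - ((((k : ℝ) * (1 - x + y) + y + 1) - x + y) /
              ((k : ℝ) * (1 - x + y) + y + 1)) +
            (1 - x + y) / ((k : ℝ) * (1 - x + y) + y + 1)))))
      (1 / ((y + 1) * (1 - x + y))) := by
  have hw : 0 < 1 - x + y := by linarith
  convert hasSum_one_div_mul_succ_linear (add_pos hy one_pos) hw using 2 with k
  have hD : 0 < (k : ℝ) * (1 - x + y) + y + 1 := by positivity
  have hD' : ((k : ℝ) + 1) * (1 - x + y) + (y + 1) =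
      (k : ℝ) * (1 - x + y) + y + 1 + (1 - x + y) := by ring
  rw [hD', ← add_assoc]
  generalize (k : ℝ) * (1 - x + y) + y + 1 = D at hD
  have h_first : (1 - x + y) / D + 1 = (D + (1 - x + y)) / D := by
    field_simp
    ring
  have h_second : 1 - (D - x + y) / D + (1 - x + y) / D = 1 / D := by
    field_simp
    ring
  have h_succ : D + (1 - x + y) ≠ 0 := by positivity
  rw [h_first, h_second]
  field_simp
end

section
/- For every (x,y) in the open triangle Δ, writing E_k = 2−x+k(1−y), the series Σ_{k=0}^∞ (1/E_k^3) · h((E_k−y)/E_k, (1−y)/E_k) converges and equals h(x,y), where h(u,v) = 1/((1−v)(1−u+v)). That is, h(x,y) = 1/((1−y)(1−x+y)) is an eigenfunction of eigenvalue 1 of the transfer operator of the triangle partition map T_{12,13,12}. -/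
/-- The telescoping series of reciprocals of products of consecutive terms of a positive
arithmetic progression. -/
theorem hasSum_one_div_mul_arith_succ {a d : ℝ} (ha : 0 < a) (hd : 0 < d) :
    HasSum (fun k : ℕ => 1 / ((a + k * d) * (a + (k + 1) * d))) (1 / (d * a)) := by
  rw [hasSum_iff_tendsto_nat_of_nonneg (fun k => by positivity)]
  have partial_sum (n : ℕ) : ∑ k ∈ Finset.range n, 1 / ((a + k * d) * (a + (k + 1) * d)) =
      1 / (d * a) - 1 / d * (a + n * d)⁻¹ := by
    induction n with
    | zero => simp; ring
    | succ n ih =>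
      have h₁ : a + n * d ≠ 0 := by positivity
      have h₂ : a + (n + 1) * d ≠ 0 := by positivity
      rw [Finset.sum_range_succ, ih]
      push_cast
      field_simp
      ring
  simp_rw [partial_sum]
  have lim : Filter.Tendsto (fun n : ℕ => a + n * d) Filter.atTop Filter.atTop :=
    Filter.tendsto_atTop_add_const_left _ _
      (tendsto_natCast_atTop_atTop.atTop_mul_const hd)
  simpa using (lim.inv_tendsto_atTop.const_mul (1 / d)).const_sub (1 / (d * a))


/-- The function `h(x,y) = 1/((1−y)(1−x+y))` is an eigenfunction of eigenvalue 1 of the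
transfer operator of the triangle partition map `T_{12,13,12}`: for every `(x,y)` in the
open triangle `Δ = {0 < y < x < 1}`, writing `E_k = 2−x+k(1−y)`, the series
`Σ_k (1/E_k^3) · h((E_k−y)/E_k, (1−y)/E_k)` converges and equals `h(x,y)`,
where `h(u,v) = 1/((1−v)(1−u+v))`. -/
theorem trip_121312_eigenfunction (x y : ℝ) (hy : 0 < y) (hyx : y < x) (hx : x < 1) :
    HasSum (fun k : ℕ =>
      (1 / (2 - x + (k : ℝ) * (1 - y)) ^ 3) *
        (1 / ((1 - (1 - y) / (2 - x + (k : ℝ) * (1 - y))) *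
          (1 - ((2 - x + (k : ℝ) * (1 - y)) - y) / (2 - x + (k : ℝ) * (1 - y)) +
            (1 - y) / (2 - x + (k : ℝ) * (1 - y))))))
      (1 / ((1 - y) * (1 - x + y))) := by
  have hd : 0 < 1 - y := by linarith
  have ha : 0 < 1 - x + y := by linarith
  convert hasSum_one_div_mul_arith_succ ha hd using 2 with k
  have hE : 2 - x + (k : ℝ) * (1 - y) = 1 - x + y + (k + 1) * (1 - y) := by ring
  have h₁ : 1 - x + y + (k : ℝ) * (1 - y) ≠ 0 := by positivity
  have h₂ : 1 - x + y + ((k : ℝ) + 1) * (1 - y) ≠ 0 := by positivity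
  rw [hE]
  set E := 1 - x + y + ((k : ℝ) + 1) * (1 - y) with hE_def
  have hv : 1 - (1 - y) / E = (1 - x + y + k * (1 - y)) / E := by
    rw [eq_div_iff h₂, sub_mul, div_mul_cancel₀ _ h₂, hE_def]
    ring
  have hu : 1 - (E - y) / E + (1 - y) / E = 1 / E := by
    field_simp
    ring
  rw [hv, hu]
  field_simp
end

section
/- For every (x,y) in the open triangle Δ, writing E_k = 2−x+k(1−y), the series Σ_{k=0}^∞ (1/E_k^3) · h((E_k+y−1)/E_k, (E_k−1)/E_k) converges and equals h(x,y), where h(u,v) = 1/((u−2)(1−v)). That is, h(x,y) = 1/((x−2)(1−y)) is an eigenfunction of eigenvalue 1 of the transfer operator of the triangle partition map T_{13,13,13}. -/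
/-- A telescoping series with nonnegative terms `f k - f (k + 1)`, where `f → l`, sums to
`f 0 - l`. -/
theorem Antitone.hasSum_sub_succ {f : ℕ → ℝ} {l : ℝ} (hf : Antitone f)
    (hl : Filter.Tendsto f Filter.atTop (nhds l)) :
    HasSum (fun k => f k - f (k + 1)) (f 0 - l) := by
  rw [hasSum_iff_tendsto_nat_of_nonneg fun k => sub_nonneg.2 (hf k.le_succ)]
  simpa only [Finset.sum_range_sub'] using hl.const_sub (f 0)

/-- The reciprocals of an arithmetic progression telescope. -/
theorem hasSum_one_div_mul_succ_arith {a d : ℝ} (ha : 0 < a) (hd : 0 < d) :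
    HasSum (fun k : ℕ => 1 / ((a + k * d) * (a + k * d + d))) (1 / (a * d)) := by
  have hpos (k : ℕ) : 0 < a + k * d := by positivity
  have hanti : Antitone fun k : ℕ => (a + k * d)⁻¹ := fun m n hmn => by
    have := hpos m
    dsimp only
    gcongr
  have hlim : Filter.Tendsto (fun k : ℕ => (a + k * d)⁻¹) Filter.atTop (nhds 0) :=
    (Filter.tendsto_atTop_add_const_left _ a
      (tendsto_natCast_atTop_atTop.atTop_mul_const hd)).inv_tendsto_atTop
  convert (hanti.hasSum_sub_succ hlim).mul_left d⁻¹ using 1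
  · rfl
  · funext k
    have h₁ := (hpos k).ne'
    have h₂ : a + k * d + d ≠ 0 := (add_pos (hpos k) hd).ne'
    have h₃ : a + ((k + 1 : ℕ) : ℝ) * d = a + k * d + d := by push_cast; ring
    rw [h₃]
    field_simp
    ring
  · simp [mul_comm]

/-- The function `h(x,y) = 1/((x−2)(1−y))` is an eigenfunction of eigenvalue 1 of the
transfer operator of the triangle partition map `T_{13,13,13}`: for every `(x,y)` in the
open triangle `Δ = {0 < y < x < 1}`, writing `E_k = 2−x+k(1−y)`, the series
`Σ_k (1/E_k^3) · h((E_k+y−1)/E_k, (E_k−1)/E_k)` converges and equals `h(x,y)`,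
where `h(u,v) = 1/((u−2)(1−v))`. -/
theorem trip_131313_eigenfunction (x y : ℝ) (hy : 0 < y) (hyx : y < x) (hx : x < 1) :
    HasSum (fun k : ℕ =>
      (1 / (2 - x + (k : ℝ) * (1 - y)) ^ 3) *
        (1 / ((((2 - x + (k : ℝ) * (1 - y)) + y - 1) / (2 - x + (k : ℝ) * (1 - y)) - 2) *
          (1 - ((2 - x + (k : ℝ) * (1 - y)) - 1) / (2 - x + (k : ℝ) * (1 - y))))))
      (1 / ((x - 2) * (1 - y))) := by
  have hd : 0 < 1 - y := by linarith
  have ha : 0 < 2 - x := by linarith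
  convert (hasSum_one_div_mul_succ_arith ha hd).neg using 1
  · rfl
  · funext k
    have hE : 0 < 2 - x + (k : ℝ) * (1 - y) := by positivity
    generalize 2 - x + (k : ℝ) * (1 - y) = E at hE ⊢
    have hEd : E + (1 - y) ≠ 0 := by positivity
    have hu : (E + y - 1) / E - 2 = -((E + (1 - y)) / E) := by field_simp; ring
    have hv : 1 - (E - 1) / E = 1 / E := by field_simp; ring
    rw [hu, hv]
    field_simp
  · rw [← neg_sub 2 x, neg_mul, one_div_neg_eq_neg_one_div]
end

section
/- For every (x,y) in the open triangle Δ, the series Σ_{k=0}^∞ (1/(kx+y+1)^3) · h(1/(kx+y+1), (1−x)/(kx+y+1)) converges and equals h(x,y), where h(u,v) = 1/(u(1−u+v)). That is, h(x,y) = 1/(x(1−x+y)) is an eigenfunction of eigenvalue 1 of the transfer operator of the triangle partition map T_{23,e,23}. -/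
/-- The function `h(x,y) = 1/(x(1−x+y))` is an eigenfunction of eigenvalue 1 of the
transfer operator of the triangle partition map `T_{23,e,23}`: for every `(x,y)` in the
open triangle `Δ = {0 < y < x < 1}`, the series
`Σ_k (1/(kx+y+1)^3) · h(1/(kx+y+1), (1−x)/(kx+y+1))` converges and equals `h(x,y)`,
where `h(u,v) = 1/(u(1−u+v))`. -/
theorem trip_23e23_eigenfunction (x y : ℝ) (hy : 0 < y) (hyx : y < x) (hx : x < 1) :
    HasSum (fun k : ℕ =>
      (1 / ((k : ℝ) * x + y + 1) ^ 3) *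
        (1 / ((1 / ((k : ℝ) * x + y + 1)) *
          (1 - 1 / ((k : ℝ) * x + y + 1) + (1 - x) / ((k : ℝ) * x + y + 1)))))
      (1 / (x * (1 - x + y))) := by
  have hx0 : 0 < x := hy.trans hyx
  have hpos (k : ℕ) : 0 < (k : ℝ) * x + (1 - x + y) := by
    have : 0 ≤ (k : ℝ) * x := by positivity
    linarith
  have hterm (k : ℕ) : (1 / ((k : ℝ) * x + y + 1) ^ 3) *
        (1 / ((1 / ((k : ℝ) * x + y + 1)) *
          (1 - 1 / ((k : ℝ) * x + y + 1) + (1 - x) / ((k : ℝ) * x + y + 1)))) =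
      1 / (x * ((k : ℝ) * x + (1 - x + y))) - 1 / (x * (((k + 1 : ℕ) : ℝ) * x + (1 - x + y))) := by
    have hD : 0 < (k : ℝ) * x + y + 1 := by linarith [hpos k]
    have hE := hpos k
    have hfactor : 1 - 1 / ((k : ℝ) * x + y + 1) + (1 - x) / ((k : ℝ) * x + y + 1) =
        ((k : ℝ) * x + (1 - x + y)) / ((k : ℝ) * x + y + 1) := by
      field_simp
      ring
    have hsucc : ((k + 1 : ℕ) : ℝ) * x + (1 - x + y) = (k : ℝ) * x + y + 1 := by
      push_cast
      ring
    rw [hfactor, hsucc]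
    field_simp
    ring
  rw [hasSum_iff_tendsto_nat_of_nonneg]
  · simp_rw [hterm]
    simp_rw [Finset.sum_range_sub' (fun k : ℕ => 1 / (x * ((k : ℝ) * x + (1 - x + y))))]
    have hlim : Filter.Tendsto (fun k : ℕ => 1 / (x * ((k : ℝ) * x + (1 - x + y))))
        Filter.atTop (nhds 0) := by
      simp_rw [one_div]
      exact ((Filter.tendsto_atTop_add_const_right _ _
        (tendsto_natCast_atTop_atTop.atTop_mul_const hx0)).const_mul_atTop hx0).inv_tendsto_atTop
    simpa using hlim.const_sub (1 / (x * (((0 : ℕ) : ℝ) * x + (1 - x + y))))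
  · intro k
    rw [hterm, sub_nonneg]
    have := hpos k
    gcongr
    exact k.le_succ
end

section
/- For every (x,y) in the open triangle Δ, writing D_k = (k+1)x−y+1, the series Σ_{k=0}^∞ (1/D_k^3) · h(1/D_k, (1−x)/D_k) converges and equals h(x,y), where h(u,v) = 1/(u(u−v+1)). That is, h(x,y) = 1/(x(x−y+1)) is an eigenfunction of eigenvalue 1 of the transfer operator of the triangle partition map T_{23,23,23}. -/
/-- The function `h(x,y) = 1/(x(x−y+1))` is an eigenfunction of eigenvalue 1 of the
transfer operator of the triangle partition map `T_{23,23,23}`: for every `(x,y)` in the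
open triangle `Δ = {0 < y < x < 1}`, writing `D_k = (k+1)x−y+1`, the series
`Σ_k (1/D_k^3) · h(1/D_k, (1−x)/D_k)` converges and equals `h(x,y)`,
where `h(u,v) = 1/(u(u−v+1))`. -/
theorem trip_232323_eigenfunction (x y : ℝ) (hy : 0 < y) (hyx : y < x) (hx : x < 1) :
    HasSum (fun k : ℕ =>
      (1 / (((k : ℝ) + 1) * x - y + 1) ^ 3) *
        (1 / ((1 / (((k : ℝ) + 1) * x - y + 1)) *
          (1 / (((k : ℝ) + 1) * x - y + 1) -
            (1 - x) / (((k : ℝ) + 1) * x - y + 1) + 1))))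
      (1 / (x * (x - y + 1))) := by
  have hx0 : 0 < x := hy.trans hyx
  have hD : ∀ k : ℕ, 0 < ((k : ℝ) + 1) * x - y + 1 := fun k => by
    have : 0 ≤ (k : ℝ) * x := by positivity
    linarith
  have hterm : ∀ k : ℕ, (1 / (((k : ℝ) + 1) * x - y + 1) ^ 3) *
        (1 / ((1 / (((k : ℝ) + 1) * x - y + 1)) *
          (1 / (((k : ℝ) + 1) * x - y + 1) -
            (1 - x) / (((k : ℝ) + 1) * x - y + 1) + 1))) =
      1 / ((((k : ℝ) + 1) * x - y + 1) * (((k : ℝ) + 1) * x - y + 1 + x)) := fun k => by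
    have hk := hD k
    generalize ((k : ℝ) + 1) * x - y + 1 = D at hk ⊢
    have hsum : 1 / D - (1 - x) / D + 1 = (D + x) / D := by
      field_simp
      ring
    have hDx : D + x ≠ 0 := by positivity
    rw [hsum]
    field_simp
  simp only [hterm]
  have hpartial : ∀ n : ℕ, ∑ k ∈ Finset.range n,
      1 / ((((k : ℝ) + 1) * x - y + 1) * (((k : ℝ) + 1) * x - y + 1 + x)) =
      1 / (x * (x - y + 1)) - 1 / x * (((n : ℝ) + 1) * x - y + 1)⁻¹ := fun n => by
    induction n with
    | zero => simp [mul_comm]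
    | succ n ih =>
      rw [Finset.sum_range_succ, ih]
      have hn := hD n
      have hnext : ((n + 1 : ℕ) + 1 : ℝ) * x - y + 1 = ((n : ℝ) + 1) * x - y + 1 + x := by
        push_cast
        ring
      rw [hnext]
      generalize ((n : ℝ) + 1) * x - y + 1 = D at hn ⊢
      have hDx : D + x ≠ 0 := by positivity
      have hstep : 1 / (D * (D + x)) = 1 / x * D⁻¹ - 1 / x * (D + x)⁻¹ := by
        field_simp
        ring
      rw [hstep]
      ring
  rw [hasSum_iff_tendsto_nat_of_nonneg (fun k => by have := hD k; positivity)]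
  simp only [hpartial]
  have htop : Filter.Tendsto (fun n : ℕ => ((n : ℝ) + 1) * x - y + 1) Filter.atTop
      Filter.atTop := by
    refine Filter.tendsto_atTop_mono (fun n => ?_)
      (tendsto_natCast_atTop_atTop.atTop_mul_const hx0)
    linarith
  simpa using (htop.inv_tendsto_atTop.const_mul (1 / x)).const_sub (1 / (x * (x - y + 1)))
end

section
/- For every (x,y) in the open triangle Δ, writing D_k = x+(k+1)(1−y), the series Σ_{k=0}^∞ (1/D_k^3) · h((D_k−y)/D_k, (D_k−1)/D_k) converges and equals h(x,y), where h(u,v) = 1/((1−v)(u−v+1)). That is, h(x,y) = 1/((1−y)(x−y+1)) is an eigenfunction of eigenvalue 1 of the transfer operator of the triangle partition map T_{123,132,132}. -/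
/-- If `D` is arithmetic with positive first term and common difference `c > 0`, then
`∑ 1 / (D k * D (k + 1))` telescopes to `1 / (c * D 0)`. -/
theorem hasSum_one_div_mul_succ_of_arithmetic (a c : ℝ) (ha : 0 < a) (hc : 0 < c) :
    HasSum (fun k : ℕ => 1 / ((a + k * c) * (a + (k + 1 : ℕ) * c))) (1 / (c * a)) := by
  have hpos (k : ℕ) : 0 < a + k * c := by positivity
  rw [hasSum_iff_tendsto_nat_of_nonneg
    fun k => (one_div_pos.2 (mul_pos (hpos k) (hpos (k + 1)))).le]
  have hsum (n : ℕ) : ∑ k ∈ Finset.range n, 1 / ((a + k * c) * (a + (k + 1 : ℕ) * c)) =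
      1 / c * (1 / a - 1 / (a + n * c)) := by
    have hterm (k : ℕ) : 1 / ((a + k * c) * (a + (k + 1 : ℕ) * c)) =
        1 / c * (1 / (a + k * c) - 1 / (a + (k + 1 : ℕ) * c)) := by
      have h₀ := (hpos k).ne'
      have h₁ := (hpos (k + 1)).ne'
      rw [div_sub_div _ _ h₀ h₁]
      field_simp
      push_cast
      ring
    simp_rw [hterm, ← Finset.mul_sum]
    rw [Finset.sum_range_sub' fun k : ℕ => 1 / (a + k * c)]
    simp
  have hlim : Filter.Tendsto (fun n : ℕ => 1 / (a + n * c)) Filter.atTop (nhds 0) := by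
    simp_rw [one_div]
    exact (Filter.tendsto_atTop_add_const_left _ a
      (tendsto_natCast_atTop_atTop.atTop_mul_const hc)).inv_tendsto_atTop
  simp_rw [hsum]
  have h := (hlim.const_sub (1 / a)).const_mul (1 / c)
  rwa [sub_zero, one_div_mul_one_div] at h


/-- The function `h(x,y) = 1/((1−y)(x−y+1))` is an eigenfunction of eigenvalue 1 of the
transfer operator of the triangle partition map `T_{123,132,132}`: for every `(x,y)` in the
open triangle `Δ = {0 < y < x < 1}`, writing `D_k = x+(k+1)(1−y)`, the series
`Σ_k (1/D_k^3) · h((D_k−y)/D_k, (D_k−1)/D_k)` converges and equals `h(x,y)`,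
where `h(u,v) = 1/((1−v)(u−v+1))`. -/
theorem trip_123132132_eigenfunction (x y : ℝ) (hy : 0 < y) (hyx : y < x) (hx : x < 1) :
    HasSum (fun k : ℕ =>
      (1 / (x + ((k : ℝ) + 1) * (1 - y)) ^ 3) *
        (1 / ((1 - ((x + ((k : ℝ) + 1) * (1 - y)) - 1) / (x + ((k : ℝ) + 1) * (1 - y))) *
          (((x + ((k : ℝ) + 1) * (1 - y)) - y) / (x + ((k : ℝ) + 1) * (1 - y)) -
            ((x + ((k : ℝ) + 1) * (1 - y)) - 1) / (x + ((k : ℝ) + 1) * (1 - y)) + 1))))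
      (1 / ((1 - y) * (x - y + 1))) := by
  have hc : 0 < 1 - y := by linarith
  have ha : 0 < x - y + 1 := by linarith
  convert hasSum_one_div_mul_succ_of_arithmetic (x - y + 1) (1 - y) ha hc using 2 with k
  have hD : 0 < x - y + 1 + k * (1 - y) := by positivity
  have hD' : 0 < x - y + 1 + k * (1 - y) + (1 - y) := by positivity
  rw [show x + ((k : ℝ) + 1) * (1 - y) = x - y + 1 + k * (1 - y) by ring,
    show x - y + 1 + ((k + 1 : ℕ) : ℝ) * (1 - y) = x - y + 1 + k * (1 - y) + (1 - y) by
      push_cast; ring]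
  generalize x - y + 1 + k * (1 - y) = D at hD hD' ⊢
  have hv : 1 - (D - 1) / D = 1 / D := by field_simp; ring
  have hu : (D - y) / D - (D - 1) / D + 1 = (D + (1 - y)) / D := by field_simp; ring
  rw [hv, hu]
  field_simp
end

section
/- Let f : Δ → ℝ be continuous and let M ≥ 0 satisfy |x·f(x,y)| ≤ M for all (x,y) ∈ Δ. Then: (i) for every (x,y) ∈ Δ and k ∈ ℕ, the point (1/(kx+y+1), x/(kx+y+1)) lies in Δ; (ii) for every (x,y) ∈ Δ the series (Lf)(x,y) = Σ_{k=0}^∞ (1/(kx+y+1)^3) f(1/(kx+y+1), x/(kx+y+1)) converges absolutely; (iii) the function Lf is continuous on Δ; and (iv) |x·(Lf)(x,y)| ≤ 2M for all (x,y) ∈ Δ. In particular the transfer operator of T_{e,e,e} maps the Banach space W = {f continuous on Δ : sup_Δ |x f(x,y)| < ∞} into itself. -/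
/-- The open triangle `Δ = {(x,y) : 0 < y < x < 1}`. -/
def triangleΔ : Set (ℝ × ℝ) := {p | 0 < p.2 ∧ p.2 < p.1 ∧ p.1 < 1}

theorem triangleΔ_denom_gt_one {p : ℝ × ℝ} (hp : p ∈ triangleΔ) (k : ℕ) :
    1 < (k : ℝ) * p.1 + p.2 + 1 := by
  obtain ⟨h1, h2, -⟩ := hp
  have : 0 ≤ (k : ℝ) * p.1 := mul_nonneg k.cast_nonneg (by linarith)
  linarith

theorem triangleΔ_inverse_branch_mem {p : ℝ × ℝ} (hp : p ∈ triangleΔ) (k : ℕ) :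
    ((1 : ℝ) / ((k : ℝ) * p.1 + p.2 + 1), p.1 / ((k : ℝ) * p.1 + p.2 + 1)) ∈ triangleΔ := by
  have hu := triangleΔ_denom_gt_one hp k
  have hu0 : 0 < (k : ℝ) * p.1 + p.2 + 1 := by linarith
  obtain ⟨h1, h2, h3⟩ := hp
  exact ⟨div_pos (h1.trans h2) hu0, (div_lt_div_iff_of_pos_right hu0).2 h3,
    (div_lt_one hu0).2 hu⟩

/-- Comparison with a telescoping sum. -/
theorem sum_range_succ_div_sq_le {a c : ℝ} (ha : 0 < a) (ha1 : a ≤ 1) (hc : 1 ≤ c) (n : ℕ) :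
    ∑ k ∈ Finset.range (n + 1), a / ((k : ℝ) * a + c) ^ 2 ≤ 2 - 1 / ((n : ℝ) * a + c) := by
  induction n with
  | zero =>
    have h1 : a / c ^ 2 ≤ 1 := (div_le_one (by positivity)).2 (by nlinarith)
    have h2 : 1 / c ≤ 1 := (div_le_one (by positivity)).2 hc
    simp only [zero_add, Finset.sum_range_one, Nat.cast_zero, zero_mul]
    linarith
  | succ n ih =>
    rw [Finset.sum_range_succ]
    have hu : 0 < (n : ℝ) * a + c := by positivity
    have hv : ((n + 1 : ℕ) : ℝ) * a + c = ((n : ℝ) * a + c) + a := by push_cast; ring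
    rw [hv]
    generalize (n : ℝ) * a + c = u at *
    have key : a / (u + a) ^ 2 ≤ 1 / u - 1 / (u + a) := by
      rw [div_sub_div _ _ hu.ne' (by positivity), one_mul, mul_one, add_sub_cancel_left]
      exact div_le_div_of_nonneg_left ha.le (by positivity) (by nlinarith)
    linarith

theorem sum_range_div_sq_le_two {a c : ℝ} (ha : 0 < a) (ha1 : a ≤ 1) (hc : 1 ≤ c) (n : ℕ) :
    ∑ k ∈ Finset.range n, a / ((k : ℝ) * a + c) ^ 2 ≤ 2 := by
  have h := sum_range_succ_div_sq_le ha ha1 hc n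
  rw [Finset.sum_range_succ] at h
  have h1 : 0 ≤ a / ((n : ℝ) * a + c) ^ 2 := by positivity
  have h2 : 0 ≤ 1 / ((n : ℝ) * a + c) := by positivity
  linarith

theorem summable_div_sq {a c : ℝ} (ha : 0 < a) (ha1 : a ≤ 1) (hc : 1 ≤ c) :
    Summable fun k : ℕ => a / ((k : ℝ) * a + c) ^ 2 :=
  summable_of_sum_range_le (fun _ => by positivity) (sum_range_div_sq_le_two ha ha1 hc)

theorem tsum_div_sq_le_two {a c : ℝ} (ha : 0 < a) (ha1 : a ≤ 1) (hc : 1 ≤ c) :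
    ∑' k : ℕ, a / ((k : ℝ) * a + c) ^ 2 ≤ 2 :=
  Real.tsum_le_of_sum_range_le (fun _ => by positivity) (sum_range_div_sq_le_two ha ha1 hc)

theorem abs_transfer_term_le {f : ℝ × ℝ → ℝ} {M : ℝ}
    (hbd : ∀ p ∈ triangleΔ, |p.1 * f p| ≤ M) {p : ℝ × ℝ} (hp : p ∈ triangleΔ) (k : ℕ) :
    |(1 / ((k : ℝ) * p.1 + p.2 + 1) ^ 3) *
        f (1 / ((k : ℝ) * p.1 + p.2 + 1), p.1 / ((k : ℝ) * p.1 + p.2 + 1))| ≤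
      M / ((k : ℝ) * p.1 + p.2 + 1) ^ 2 := by
  have hu := triangleΔ_denom_gt_one hp k
  have h := hbd _ (triangleΔ_inverse_branch_mem hp k)
  generalize (k : ℝ) * p.1 + p.2 + 1 = u at *
  have hu0 : 0 < u := by linarith
  have e : 1 / u ^ 3 * f (1 / u, p.1 / u) = 1 / u * f (1 / u, p.1 / u) / u ^ 2 := by
    field_simp
  rw [e, abs_div, abs_of_pos (pow_pos hu0 2)]
  exact div_le_div_of_nonneg_right h (by positivity)

/-- The transfer operator of `T_{e,e,e}` maps the Banach space
`W = {f continuous on Δ : sup_Δ |x f(x,y)| < ∞}` into itself: if `f` is continuous on `Δ`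
with `|x·f(x,y)| ≤ M` on `Δ`, then (i) all points where `f` is evaluated lie in `Δ`,
(ii) the defining series converges absolutely, (iii) `Lf` is continuous on `Δ`, and
(iv) `|x·(Lf)(x,y)| ≤ 2M` on `Δ`. -/
theorem trip_eee_transfer_maps_W (f : ℝ × ℝ → ℝ) (hf : ContinuousOn f triangleΔ)
    (M : ℝ) (hM : 0 ≤ M) (hbd : ∀ p ∈ triangleΔ, |p.1 * f p| ≤ M) :
    (∀ p ∈ triangleΔ, ∀ k : ℕ,
      ((1 : ℝ) / ((k : ℝ) * p.1 + p.2 + 1), p.1 / ((k : ℝ) * p.1 + p.2 + 1)) ∈ triangleΔ) ∧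
    (∀ p ∈ triangleΔ, Summable (fun k : ℕ =>
      |(1 / ((k : ℝ) * p.1 + p.2 + 1) ^ 3) *
        f (1 / ((k : ℝ) * p.1 + p.2 + 1), p.1 / ((k : ℝ) * p.1 + p.2 + 1))|)) ∧
    ContinuousOn (fun p : ℝ × ℝ => ∑' k : ℕ,
      (1 / ((k : ℝ) * p.1 + p.2 + 1) ^ 3) *
        f (1 / ((k : ℝ) * p.1 + p.2 + 1), p.1 / ((k : ℝ) * p.1 + p.2 + 1))) triangleΔ ∧
    (∀ p ∈ triangleΔ,
      |p.1 * ∑' k : ℕ, (1 / ((k : ℝ) * p.1 + p.2 + 1) ^ 3) *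
        f (1 / ((k : ℝ) * p.1 + p.2 + 1), p.1 / ((k : ℝ) * p.1 + p.2 + 1))| ≤ 2 * M) := by
  have hsum : ∀ p ∈ triangleΔ, Summable fun k : ℕ =>
      |(1 / ((k : ℝ) * p.1 + p.2 + 1) ^ 3) *
        f (1 / ((k : ℝ) * p.1 + p.2 + 1), p.1 / ((k : ℝ) * p.1 + p.2 + 1))| := by
    intro p hp
    have hx : 0 < p.1 := hp.1.trans hp.2.1
    have hs := (summable_div_sq (c := p.2 + 1) hx hp.2.2.le (by linarith [hp.1])).mul_left
      (M / p.1)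
    refine Summable.of_nonneg_of_le (fun _ => abs_nonneg _) (fun k => ?_) hs
    refine (abs_transfer_term_le hbd hp k).trans_eq ?_
    rw [← add_assoc, div_mul_div_comm, mul_comm M, mul_div_mul_left _ _ hx.ne']
  refine ⟨fun p hp k => triangleΔ_inverse_branch_mem hp k, hsum, ?_, ?_⟩
  · intro p₀ hp₀
    have hx₀ : 0 < p₀.1 := hp₀.1.trans hp₀.2.1
    set a := p₀.1 / 2 with ha_def
    have ha : 0 < a := half_pos hx₀
    have ha1 : a ≤ 1 := by linarith [hp₀.2.2]
    set V : Set (ℝ × ℝ) := {p | a < p.1}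
    have hV : V ∈ nhds p₀ :=
      (isOpen_lt continuous_const continuous_fst).mem_nhds (half_lt_self hx₀)
    refine (continuousWithinAt_inter hV).1 ?_
    have hs := (summable_div_sq (c := 1) ha ha1 le_rfl).mul_left (M / a)
    refine continuousOn_tsum (fun k => ?_) hs (fun k p hp => ?_) p₀ ⟨hp₀, mem_of_mem_nhds hV⟩
    · have hu : ∀ p ∈ triangleΔ ∩ V, (k : ℝ) * p.1 + p.2 + 1 ≠ 0 := fun p hp =>
        (zero_lt_one.trans (triangleΔ_denom_gt_one hp.1 k)).ne'
      have hcu : ContinuousOn (fun p : ℝ × ℝ => (k : ℝ) * p.1 + p.2 + 1) (triangleΔ ∩ V) := by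
        fun_prop
      refine (continuousOn_const.div (hcu.pow 3) fun p hp => pow_ne_zero 3 (hu p hp)).mul ?_
      exact hf.comp ((continuousOn_const.div hcu hu).prodMk (continuousOn_fst.div hcu hu))
        fun p hp => triangleΔ_inverse_branch_mem hp.1 k
    · rw [Real.norm_eq_abs]
      refine (abs_transfer_term_le hbd hp.1 k).trans ?_
      rw [div_mul_div_comm, mul_comm M, mul_div_mul_left _ _ ha.ne']
      have h1 : (k : ℝ) * a ≤ k * p.1 := mul_le_mul_of_nonneg_left (le_of_lt hp.2) k.cast_nonneg
      have h2 : (k : ℝ) * a + 1 ≤ k * p.1 + p.2 + 1 := by linarith [hp.1.1]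
      exact div_le_div_of_nonneg_left hM (by positivity)
        (pow_le_pow_left₀ (by positivity) h2 2)
  · intro p hp
    have hx : 0 < p.1 := hp.1.trans hp.2.1
    have hc : 1 ≤ p.2 + 1 := by linarith [hp.1]
    have hs := (summable_div_sq hx hp.2.2.le hc).mul_left M
    rw [← tsum_mul_left, ← Real.norm_eq_abs]
    refine (tsum_of_norm_bounded hs.hasSum fun k => ?_).trans ?_
    · rw [Real.norm_eq_abs, abs_mul, abs_of_pos hx]
      refine (mul_le_mul_of_nonneg_left (abs_transfer_term_le hbd hp k) hx.le).trans_eq ?_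
      rw [← add_assoc]
      ring
    · rw [tsum_mul_left, mul_comm]
      exact mul_le_mul_of_nonneg_right (tsum_div_sq_le_two hx hp.2.2.le hc) hM
end

section
/- Let W be a subspace of the real vector space of functions Δ → ℝ and let L : W → W be a linear map such that whenever f, g ∈ W satisfy f(x,y) < g(x,y) for all (x,y) ∈ Δ, then (Lf)(x,y) < (Lg)(x,y) for all (x,y) ∈ Δ. Suppose h ∈ W satisfies Lh = h and h(x,y) > 0 for all (x,y) ∈ Δ. Suppose φ ∈ W satisfies Lφ = λφ for some real λ, there is a point (x₀,y₀) ∈ Δ with φ(x₀,y₀) ≠ 0, and there is a constant B > 0 with −B·h(x,y) < φ(x,y) < B·h(x,y) for all (x,y) ∈ Δ. Then −1 ≤ λ ≤ 1. -/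
/-- Iterating a strictly order-preserving linear map preserves the two-sided bound
`−B·h < φ < B·h` when `h` is a fixed point and `φ` an eigenvector. -/
theorem pow_smul_eigenvector_dominated {X : Type*} (W : Submodule ℝ (X → ℝ))
    (L : W →ₗ[ℝ] W)
    (hmono : ∀ f g : W, (∀ p, (f : X → ℝ) p < (g : X → ℝ) p) →
      ∀ p, (L f : X → ℝ) p < (L g : X → ℝ) p)
    (h : W) (hfix : L h = h) (φ : W) (lam : ℝ) (heig : L φ = lam • φ) (B : ℝ)
    (hdom : ∀ p, -B * (h : X → ℝ) p < (φ : X → ℝ) p ∧ (φ : X → ℝ) p < B * (h : X → ℝ) p)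
    (n : ℕ) (p : X) : |lam ^ n * (φ : X → ℝ) p| < B * (h : X → ℝ) p := by
  induction n generalizing p with
  | zero => simpa [abs_lt] using hdom p
  | succ n ih =>
    have lower := hmono ((-B) • h) (lam ^ n • φ)
      (fun q => by simpa using (abs_lt.mp (ih q)).1) p
    have upper := hmono (lam ^ n • φ) (B • h)
      (fun q => by simpa using (abs_lt.mp (ih q)).2) p
    simp only [map_smul, hfix, heig, Submodule.coe_smul, Pi.smul_apply, smul_eq_mul]
      at lower upper
    rw [abs_lt, pow_succ, mul_assoc, ← neg_mul]
    exact ⟨lower, upper⟩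

/-- Let `W` be a subspace of the functions `Δ → ℝ` and `L : W → W` a linear map that is
strictly order-preserving pointwise. If `h ∈ W` is a positive fixed point of `L`, and
`φ ∈ W` is a nonzero eigenvector of `L` with eigenvalue `λ` satisfying
`−B·h < φ < B·h` pointwise for some `B > 0`, then `−1 ≤ λ ≤ 1`. -/
theorem eigenvalue_bound_of_dominated (W : Submodule ℝ (triangleΔ → ℝ))
    (L : W →ₗ[ℝ] W)
    (hmono : ∀ f g : W, (∀ p : triangleΔ, (f : triangleΔ → ℝ) p < (g : triangleΔ → ℝ) p) →
      ∀ p : triangleΔ, (L f : triangleΔ → ℝ) p < (L g : triangleΔ → ℝ) p)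
    (h : W) (hfix : L h = h) (hpos : ∀ p : triangleΔ, 0 < (h : triangleΔ → ℝ) p)
    (φ : W) (lam : ℝ) (heig : L φ = lam • φ)
    (hne : ∃ p : triangleΔ, (φ : triangleΔ → ℝ) p ≠ 0)
    (B : ℝ) (hB : 0 < B)
    (hdom : ∀ p : triangleΔ,
      -B * (h : triangleΔ → ℝ) p < (φ : triangleΔ → ℝ) p ∧
      (φ : triangleΔ → ℝ) p < B * (h : triangleΔ → ℝ) p) :
    -1 ≤ lam ∧ lam ≤ 1 := by
  obtain ⟨p, hp⟩ := hne
  refine abs_le.mp (le_of_not_gt fun hlam => ?_)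
  obtain ⟨n, hn⟩ := pow_unbounded_of_one_lt
    (B * (h : triangleΔ → ℝ) p / |(φ : triangleΔ → ℝ) p|) hlam
  have bound := pow_smul_eigenvector_dominated W L hmono h hfix φ lam heig B hdom n p
  rw [div_lt_iff₀ (abs_pos.mpr hp), ← abs_pow, ← abs_mul] at hn
  exact lt_asymm hn bound
end

section
/- Let W be the space of continuous functions f on Δ with sup_{(x,y)∈Δ} |x f(x,y)| finite, and let L be the transfer operator of the triangle partition map T_{e,e,e}, i.e. (Lf)(x,y) = Σ_{k=0}^∞ (1/(kx+y+1)^3) f(1/(kx+y+1), x/(kx+y+1)). If φ ∈ W is not identically zero on Δ and satisfies (Lφ)(x,y) = λ·φ(x,y) for all (x,y) ∈ Δ for some real λ, then −1 ≤ λ ≤ 1. Hence the largest eigenvalue of L on W is 1, attained by φ(x,y) = 1/(x(y+1)). -/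
/-- The transfer operator of the triangle partition map `T_{e,e,e}`. -/
noncomputable def transferEEE (f : ℝ × ℝ → ℝ) : ℝ × ℝ → ℝ := fun p =>
  ∑' k : ℕ, (1 / ((k : ℝ) * p.1 + p.2 + 1) ^ 3) *
    f (1 / ((k : ℝ) * p.1 + p.2 + 1), p.1 / ((k : ℝ) * p.1 + p.2 + 1))

open Filter Topology in
/-- The series defining the transfer operator at `1 / (x (y + 1))` telescopes. -/
theorem hasSum_transferEEE_invariantDensity {p : ℝ × ℝ} (hp : p ∈ triangleΔ) :
    HasSum (fun k : ℕ => (1 / ((k : ℝ) * p.1 + p.2 + 1) ^ 3) *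
      (1 / (1 / ((k : ℝ) * p.1 + p.2 + 1) * (p.1 / ((k : ℝ) * p.1 + p.2 + 1) + 1))))
      (1 / (p.1 * (p.2 + 1))) := by
  obtain ⟨x, y⟩ := p
  obtain ⟨hy, hyx, -⟩ : 0 < y ∧ y < x ∧ x < 1 := hp
  have hx : 0 < x := hy.trans hyx
  rw [hasSum_iff_tendsto_nat_of_nonneg (fun k => by positivity)]
  have hsum (n : ℕ) : ∑ k ∈ Finset.range n, (1 / ((k : ℝ) * x + y + 1) ^ 3) *
      (1 / (1 / ((k : ℝ) * x + y + 1) * (x / ((k : ℝ) * x + y + 1) + 1))) =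
      1 / (x * (y + 1)) - 1 / x * ((n : ℝ) * x + y + 1)⁻¹ := by
    induction n with
    | zero => simp; ring
    | succ n ih =>
      rw [Finset.sum_range_succ, ih]
      push_cast
      have hu : (n : ℝ) * x + y + 1 ≠ 0 := by positivity
      have hv : ((n : ℝ) + 1) * x + y + 1 ≠ 0 := by positivity
      have hw : x + ((n : ℝ) * x + y + 1) ≠ 0 := by positivity
      have hv' : ((n : ℝ) + 1) * x + y + 1 = x + ((n : ℝ) * x + y + 1) := by ring
      rw [hv']
      generalize (n : ℝ) * x + y + 1 = u at *
      field_simp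
      ring
  simp only [hsum]
  have hlim : Tendsto (fun n : ℕ => (n : ℝ) * x + y + 1) atTop atTop :=
    tendsto_atTop_add_const_right _ _ (tendsto_atTop_add_const_right _ _
      (tendsto_natCast_atTop_atTop.atTop_mul_const hx))
  simpa using (hlim.inv_tendsto_atTop.const_mul (1 / x)).const_sub (1 / (x * (y + 1)))

/-- The inverse branches of `T_{e,e,e}` map the triangle into itself. -/
theorem inverseBranch_mem_triangleΔ {p : ℝ × ℝ} (hp : p ∈ triangleΔ) (k : ℕ) :
    (1 / ((k : ℝ) * p.1 + p.2 + 1), p.1 / ((k : ℝ) * p.1 + p.2 + 1)) ∈ triangleΔ := by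
  obtain ⟨hy, hyx, hx1⟩ := hp
  have hx : 0 < p.1 := hy.trans hyx
  have hu : 0 < (k : ℝ) * p.1 + p.2 + 1 := by positivity
  have hk : 0 ≤ (k : ℝ) * p.1 := by positivity
  exact ⟨div_pos hx hu, div_lt_div_of_pos_right hx1 hu, (div_lt_one hu).2 (by linarith)⟩

/-- The transfer operator does not increase the supremum of `|f| x (y + 1)`. -/
theorem abs_transferEEE_mul_le {f : ℝ × ℝ → ℝ} {M : ℝ}
    (hf : ∀ q ∈ triangleΔ, |f q| * (q.1 * (q.2 + 1)) ≤ M) {p : ℝ × ℝ} (hp : p ∈ triangleΔ) :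
    |transferEEE f p| * (p.1 * (p.2 + 1)) ≤ M := by
  have hpos : ∀ q ∈ triangleΔ, 0 < q.1 * (q.2 + 1) := fun q hq =>
    mul_pos (hq.1.trans hq.2.1) (by linarith [hq.1])
  have hbound := tsum_of_norm_bounded ((hasSum_transferEEE_invariantDensity hp).mul_left M)
    (f := fun k : ℕ => (1 / ((k : ℝ) * p.1 + p.2 + 1) ^ 3) *
      f (1 / ((k : ℝ) * p.1 + p.2 + 1), p.1 / ((k : ℝ) * p.1 + p.2 + 1))) fun k => by
    have hq := inverseBranch_mem_triangleΔ hp k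
    have hu : 0 < (k : ℝ) * p.1 + p.2 + 1 := by
      have := hp.1
      have := hp.1.trans hp.2.1
      positivity
    have hfq := (le_div_iff₀ (hpos _ hq)).2 (hf _ hq)
    rw [norm_mul, Real.norm_of_nonneg (by positivity), Real.norm_eq_abs, mul_left_comm,
      mul_one_div M]
    exact mul_le_mul_of_nonneg_left hfq (by positivity)
  rw [mul_one_div] at hbound
  exact (le_div_iff₀ (hpos p hp)).1 hbound

/-- In the Banach space `W` of continuous functions `f` on `Δ` with `sup_Δ |x f(x,y)| < ∞`,
every eigenvalue `λ` of the transfer operator `L` of `T_{e,e,e}` (for a not-identically-zero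
eigenfunction `φ ∈ W`) satisfies `−1 ≤ λ ≤ 1`; and the largest eigenvalue `1` is attained
by `φ(x,y) = 1/(x(y+1))`, i.e. `L` fixes this function on `Δ`. -/
theorem trip_eee_largest_eigenvalue_one (φ : ℝ × ℝ → ℝ) (lam : ℝ)
    (hφcont : ContinuousOn φ triangleΔ)
    (hφbdd : ∃ C : ℝ, ∀ p ∈ triangleΔ, |p.1 * φ p| ≤ C)
    (hφne : ∃ p ∈ triangleΔ, φ p ≠ 0)
    (heig : ∀ p ∈ triangleΔ, transferEEE φ p = lam * φ p) :
    (-1 ≤ lam ∧ lam ≤ 1) ∧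
    (∀ p ∈ triangleΔ,
      transferEEE (fun q : ℝ × ℝ => 1 / (q.1 * (q.2 + 1))) p = 1 / (p.1 * (p.2 + 1))) := by
  refine ⟨abs_le.1 ?_, fun p hp => (hasSum_transferEEE_invariantDensity hp).tsum_eq⟩
  obtain ⟨C, hC⟩ := hφbdd
  obtain ⟨p, hp, hφp⟩ := hφne
  let S := (fun q : ℝ × ℝ => |φ q| * (q.1 * (q.2 + 1))) '' triangleΔ
  have hS : BddAbove S := by
    refine ⟨C * 2, ?_⟩
    rintro _ ⟨q, hq, rfl⟩
    have hCq := hC q hq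
    have hC0 : 0 ≤ C := (abs_nonneg _).trans hCq
    obtain ⟨hy, hyx, hx1⟩ := hq
    rw [abs_mul, abs_of_pos (hy.trans hyx)] at hCq
    have := mul_le_mul hCq (by linarith : q.2 + 1 ≤ 2) (by linarith) hC0
    linarith
  have hle : ∀ q ∈ triangleΔ, |φ q| * (q.1 * (q.2 + 1)) ≤ sSup S := fun q hq =>
    le_csSup hS ⟨q, hq, rfl⟩
  have hSpos : 0 < sSup S := lt_of_lt_of_le
    (mul_pos (abs_pos.2 hφp) (mul_pos (hp.1.trans hp.2.1) (by linarith [hp.1]))) (hle p hp)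
  by_contra! hlam
  have hSle : sSup S ≤ sSup S / |lam| := by
    refine csSup_le ⟨_, p, hp, rfl⟩ ?_
    rintro _ ⟨q, hq, rfl⟩
    have := abs_transferEEE_mul_le hle hq
    rw [heig q hq, abs_mul] at this
    rw [le_div_iff₀ (by linarith)]
    linarith
  exact (div_lt_self hSpos hlam).not_ge hSle
end

section
/- The probability that the digit 0 occurs in the triangle partition expansion under T_{e,23,e} is 1/2; precisely, ∫_{1/2}^{1} ( ∫_{1−x}^{x} 6/(π² · x · (1−y)) dy ) dx = 1/2. -/
open Set in
/-- The dilogarithm series is continuous on `[-1, 1]`. -/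
lemma continuousOn_tsum_pow_div_sq :
    ContinuousOn (fun u : ℝ => ∑' n : ℕ, u ^ n / (n : ℝ) ^ 2) (Icc (-1) 1) := by
  refine continuousOn_tsum (u := fun n : ℕ => 1 / (n : ℝ) ^ 2) (fun n => by fun_prop)
    hasSum_zeta_two.summable ?_
  intro n u hu
  have h : |u| ^ n ≤ 1 := pow_le_one₀ (abs_nonneg u) (abs_le.mpr hu)
  rw [Real.norm_eq_abs, abs_div, abs_pow, abs_of_nonneg (sq_nonneg (n : ℝ))]
  gcongr

/-- The derivative of the dilogarithm series on the punctured open unit interval. -/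
lemma hasDerivAt_tsum_pow_div_sq {u : ℝ} (hu : |u| < 1) (hu0 : u ≠ 0) :
    HasDerivAt (fun u : ℝ => ∑' n : ℕ, u ^ n / (n : ℝ) ^ 2) (-Real.log (1 - u) / u) u := by
  obtain ⟨r, hur, hr1⟩ := exists_between hu
  have hr0 : 0 < r := (abs_nonneg u).trans_lt hur
  have hsum : Summable fun n : ℕ => r ^ (n - 1) :=
    (summable_nat_add_iff 1).mp (by simpa using summable_geometric_of_lt_one hr0.le hr1)
  have key := hasDerivAt_tsum_of_isPreconnected (t := Set.Ioo (-r) r)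
    (g := fun (n : ℕ) (u : ℝ) => u ^ n / (n : ℝ) ^ 2)
    (g' := fun (n : ℕ) (u : ℝ) => (n : ℝ) * u ^ (n - 1) / (n : ℝ) ^ 2)
    hsum isOpen_Ioo isPreconnected_Ioo
    (fun n y _ => (hasDerivAt_pow n y).div_const _)
    (fun n y hy => by
      rcases Nat.eq_zero_or_pos n with rfl | hn
      · simp
      have hn1 : (1 : ℝ) ≤ n := by exact_mod_cast hn
      have hy' : |y| ≤ r := (abs_lt.mpr hy).le
      rw [show (n : ℝ) * y ^ (n - 1) / (n : ℝ) ^ 2 = y ^ (n - 1) / n by field_simp,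
        Real.norm_eq_abs, abs_div, abs_pow, Nat.abs_cast]
      calc |y| ^ (n - 1) / n ≤ |y| ^ (n - 1) := div_le_self (by positivity) hn1
        _ ≤ r ^ (n - 1) := by gcongr)
    (y₀ := 0) ⟨by linarith, hr0⟩
    (by
      refine summable_of_ne_finset_zero (s := ∅) fun n _ => ?_
      rcases Nat.eq_zero_or_pos n with rfl | hn
      · simp
      · simp [hn.ne'])
    (abs_lt.mp hur)
  have hlog := (Real.hasSum_pow_div_log_of_abs_lt_one hu).div_const u
  have h0 : HasSum (fun n : ℕ => (n : ℝ) * u ^ (n - 1) / (n : ℝ) ^ 2) (-Real.log (1 - u) / u) := by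
    rw [← hasSum_nat_add_iff' 1]
    simp only [Finset.sum_range_one, Nat.cast_zero, zero_mul, zero_div, sub_zero]
    refine hlog.congr_fun fun n => ?_
    have : (n : ℝ) + 1 ≠ 0 := by positivity
    simp only [Nat.add_sub_cancel, Nat.cast_add, Nat.cast_one]
    field_simp
    ring
  exact key.congr_deriv h0.tsum_eq

lemma tsum_neg_one_pow_div_sq :
    ∑' n : ℕ, (-1 : ℝ) ^ n / (n : ℝ) ^ 2 = -(Real.pi ^ 2 / 12) := by
  have hz := hasSum_zeta_two
  have heven : HasSum (fun n : ℕ => if Even n then 1 / (n : ℝ) ^ 2 else 0)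
      (Real.pi ^ 2 / 6 / 4) := by
    rw [← Function.Injective.hasSum_iff (g := fun n : ℕ => 2 * n)
      (fun a b h => by simpa using h)]
    · refine (hz.div_const 4).congr_fun fun n => ?_
      simp only [Function.comp_apply, even_two_mul, if_true, Nat.cast_mul, Nat.cast_ofNat]
      rw [div_div]
      ring
    · intro n hn
      rw [if_neg]
      rintro ⟨k, hk⟩
      exact hn ⟨k, by simp only; omega⟩
  have h := (heven.mul_left 2).sub hz
  rw [show -(Real.pi ^ 2 / 12) = 2 * (Real.pi ^ 2 / 6 / 4) - Real.pi ^ 2 / 6 by ring, ← h.tsum_eq]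
  congr 1
  ext n
  split_ifs with hn
  · rw [hn.neg_one_pow]; ring
  · rw [(Nat.not_even_iff_odd.mp hn).neg_one_pow]; ring

lemma continuousAt_log_one_sub_mul_log {x : ℝ} (hx : 0 < x) :
    ContinuousAt (fun x : ℝ => Real.log (1 - x) * Real.log x) x := by
  have heq : (fun x : ℝ => Real.log (1 - x) * Real.log x)
      = fun x => -((1 - x) * Real.log (1 - x)) * dslope Real.log 1 x := by
    ext y
    have := sub_smul_dslope Real.log 1 y
    rw [Real.log_one, sub_zero, smul_eq_mul] at this
    rw [← this]
    ring
  rw [heq]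
  have h1 : Continuous fun x : ℝ => -((1 - x) * Real.log (1 - x)) :=
    (Real.continuous_mul_log.comp (continuous_const.sub continuous_id)).neg
  refine h1.continuousAt.mul ?_
  rcases eq_or_ne x 1 with rfl | hx1
  · exact continuousAt_dslope_same.mpr (Real.differentiableAt_log one_ne_zero)
  · exact (continuousAt_dslope_of_ne hx1).mpr (Real.continuousAt_log hx.ne')

open Set in
lemma integral_log_sub_log_one_sub_div :
    ∫ x in (1/2 : ℝ)..1, (Real.log x - Real.log (1 - x)) / x = Real.pi ^ 2 / 12 := by
  set D : ℝ → ℝ := fun u => ∑' n : ℕ, u ^ n / (n : ℝ) ^ 2 with hD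
  set H : ℝ → ℝ := fun x => Real.log x * Real.log x - Real.log (1 - x) * Real.log x
    + D (1 - x⁻¹) with hH
  have hle : (1/2 : ℝ) ≤ 1 := by norm_num
  have hcont : ContinuousOn H (Icc (1/2) 1) := by
    have hlog : ContinuousOn Real.log (Icc (1/2 : ℝ) 1) := fun x hx =>
      (Real.continuousAt_log (by linarith [hx.1])).continuousWithinAt
    refine ((hlog.mul hlog).sub fun x hx =>
      (continuousAt_log_one_sub_mul_log (by linarith [hx.1])).continuousWithinAt).add ?_
    refine continuousOn_tsum_pow_div_sq.comp (t := Icc (-1) 1) ?_ ?_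
    · exact continuousOn_const.sub
        (continuousOn_id.inv₀ fun x hx => ne_of_gt (by simp only [id]; linarith [hx.1]))
    · intro x hx
      have hx0 : 0 < x := by linarith [hx.1]
      have h2 : x⁻¹ ≤ 2 := by
        rw [inv_le_comm₀ hx0 two_pos]; linarith [hx.1]
      exact ⟨by linarith, by linarith [inv_pos.mpr hx0]⟩
  have hderiv : ∀ x ∈ Ioo (1/2 : ℝ) 1,
      HasDerivAt H ((Real.log x - Real.log (1 - x)) / x) x := by
    intro x hx
    have hx0 : 0 < x := by linarith [hx.1]
    have hx1 : 0 < 1 - x := by linarith [hx.2]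
    have h2 : x⁻¹ < 2 := by
      rw [inv_lt_comm₀ hx0 two_pos]; linarith [hx.1]
    have h1 : 1 < x⁻¹ := (one_lt_inv₀ hx0).mpr hx.2
    have hDd := hasDerivAt_tsum_pow_div_sq (u := 1 - x⁻¹)
      (abs_lt.mpr ⟨by linarith, by linarith⟩) (by linarith)
    have hl := Real.hasDerivAt_log hx0.ne'
    have hl1 := ((hasDerivAt_id x).const_sub 1).log hx1.ne'
    have hu := (hasDerivAt_inv hx0.ne').const_sub 1
    refine (((hl.mul hl).sub (hl1.mul hl)).add (hDd.comp x hu)).congr_deriv ?_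
    simp only [id, sub_sub_cancel, Real.log_inv]
    have hx2 : x - 1 ≠ 0 := by linarith
    rw [show 1 - x⁻¹ = -(1 - x) / x by field_simp; ring]
    field_simp
    ring
  have hint : IntervalIntegrable (fun x => (Real.log x - Real.log (1 - x)) / x)
      MeasureTheory.volume (1/2) 1 := by
    refine intervalIntegral.intervalIntegrable_deriv_of_nonneg (g := H) ?_ ?_ ?_
    · rwa [uIcc_of_le hle]
    · rwa [min_eq_left hle, max_eq_right hle]
    · rw [min_eq_left hle, max_eq_right hle]
      intro x hx
      have hlog : Real.log (1 - x) ≤ Real.log x :=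
        Real.log_le_log (by linarith [hx.2]) (by linarith [hx.1])
      exact div_nonneg (by linarith) (by linarith [hx.1])
  rw [intervalIntegral.integral_eq_sub_of_hasDerivAt_of_le hle hcont hderiv hint]
  have hD0 : D 0 = 0 := by
    rw [hD]
    refine (tsum_congr fun n => ?_).trans tsum_zero
    rcases Nat.eq_zero_or_pos n with rfl | hn
    · simp
    · simp [hn.ne']
  have hDneg : D (-1) = -(Real.pi ^ 2 / 12) := tsum_neg_one_pow_div_sq
  have e1 : H 1 = 0 := by simp [hH, hD0]
  have e2 : H (1/2) = -(Real.pi ^ 2 / 12) := by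
    simp only [hH]
    rw [show (1 : ℝ) - (1/2)⁻¹ = -1 by norm_num, show (1 : ℝ) - 1/2 = 1/2 by norm_num, hDneg]
    ring
  rw [e1, e2]
  ring

lemma integral_inv_one_sub {x : ℝ} (hx0 : 0 < x) (hx1 : x < 1) :
    ∫ y in (1 - x)..x, (1 - y)⁻¹ = Real.log x - Real.log (1 - x) := by
  rw [intervalIntegral.integral_comp_sub_left (fun y : ℝ => y⁻¹) 1, sub_sub_cancel,
    integral_inv_of_pos (by linarith) hx0, Real.log_div hx0.ne' (by linarith)]


/-- Gauss–Kuzmin probability of digit `0` for the triangle partition map `T_{e,23,e}`: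
the measure of `Δ₀ = {(x,y) ∈ Δ : 1−x < y}` under the invariant density
`6/(π² x (1−y))` equals `1/2`. -/
theorem trip_e23e_gaussKuzmin_p0 :
    (∫ x in (1/2 : ℝ)..1, ∫ y in (1 - x)..x, 6 / (Real.pi ^ 2 * x * (1 - y))) = 1/2 := by
  have hinner : ∀ x ∈ Set.Ioo (1/2 : ℝ) 1,
      (∫ y in (1 - x)..x, 6 / (Real.pi ^ 2 * x * (1 - y)))
        = 6 / Real.pi ^ 2 * ((Real.log x - Real.log (1 - x)) / x) := by
    intro x hx
    have hx0 : 0 < x := by linarith [hx.1]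
    rw [← integral_inv_one_sub hx0 hx.2, div_eq_inv_mul _ x, ← mul_assoc,
      ← intervalIntegral.integral_const_mul]
    congr 1
    ext y
    simp only [div_eq_mul_inv, mul_inv]
    ring
  rw [intervalIntegral.integral_congr_Ioo_of_le (by norm_num) hinner,
    intervalIntegral.integral_const_mul, integral_log_sub_log_one_sub_div]
  field_simp
  norm_num
end
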